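/- arXiv:2405.18045 — 2 statements merged into one kernel-verified Lean document; each statement's English description precedes it below -/
import Mathlib

section
/- Let τ > 0 and let μ be a Borel probability measure on S^{d−1} × S^{d−1} with both marginals equal to p. For M ≥ 2 define the mini-batch InfoNCE loss L_M(U,V) = (1/M) Σ_{i=1}^M −log( exp(u_i·v_i/τ) / Σ_{j=1}^M exp(u_i·v_j/τ) ). Then as M → ∞, the expectation over an i.i.d. sample ((u_1,v_1),…,(u_M,v_M)) ∼ μ^M of L_M, minus log(M−1), converges to E_{(u,v)∼μ}[ −u·v/τ ] + E_{u′∼p}[ log E_{u∼p}[ exp(u·u′/τ) ] ]. -/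
open scoped BigOperators RealInnerProductSpace
open MeasureTheory Filter

noncomputable section

/-- The unit sphere `S^{d-1}` in `ℝ^d`. -/
abbrev Sph (d : ℕ) := Metric.sphere (0 : EuclideanSpace ℝ (Fin d)) 1

/-- Mini-batch InfoNCE loss with temperature `τ` evaluated on a batch `W` of `M`
positive pairs of points of the sphere. -/
def LnceBatch (d M : ℕ) (τ : ℝ) (W : Fin M → Sph d × Sph d) : ℝ :=
  (1 / (M : ℝ)) * ∑ i, -Real.log
    (Real.exp (⟪((W i).1 : EuclideanSpace ℝ (Fin d)),
        ((W i).2 : EuclideanSpace ℝ (Fin d))⟫ / τ) /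
      ∑ j, Real.exp (⟪((W i).1 : EuclideanSpace ℝ (Fin d)),
        ((W j).2 : EuclideanSpace ℝ (Fin d))⟫ / τ))

open ProbabilityTheory in
/-- A kernel that is centered in its second variable makes distinct samples uncorrelated. -/
theorem integral_mul_eq_zero_of_centered {ι X : Type*} [Fintype ι] [MeasurableSpace X]
    (μ : Measure X) [IsProbabilityMeasure μ] {h : X → X → ℝ}
    (hm : Measurable (Function.uncurry h)) {C : ℝ} (hC : ∀ x y, |h x y| ≤ C)
    (h0 : ∀ x, ∫ y, h x y ∂μ = 0) {i j l : ι} (hil : i ≠ l) (hjl : j ≠ l) :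
    ∫ W, h (W i) (W j) * h (W i) (W l) ∂(Measure.pi fun _ : ι => μ) = 0 := by
  set P := Measure.pi fun _ : ι => μ
  have hind : iIndepFun (fun (a : ι) (W : ι → X) => W a) P :=
    iIndepFun_pi (μ := fun _ : ι => μ) (X := fun _ x => x) (fun _ => aemeasurable_id)
  have hpair : IndepFun (fun W : ι → X => (W i, W j)) (fun W => W l) P :=
    hind.indepFun_prodMk (fun a => measurable_pi_apply a) i j l hil hjl
  have hmp : Measurable fun W : ι → X => (W i, W j) := by fun_prop
  have hml : Measurable fun W : ι → X => W l := by fun_prop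
  have hmap := (indepFun_iff_map_prod_eq_prod_map_map hmp.aemeasurable hml.aemeasurable).1 hpair
  have hl : P.map (fun W : ι → X => W l) = μ :=
    (measurePreserving_eval (fun _ : ι => μ) l).map_eq
  have : IsProbabilityMeasure (P.map fun W : ι → X => (W i, W j)) :=
    Measure.isProbabilityMeasure_map hmp.aemeasurable
  have hg : Measurable fun q : (X × X) × X => h q.1.1 q.1.2 * h q.1.1 q.2 :=
    (hm.comp measurable_fst).mul
      (hm.comp ((measurable_fst.comp measurable_fst).prodMk measurable_snd))
  have hint : Integrable (fun q : (X × X) × X => h q.1.1 q.1.2 * h q.1.1 q.2)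
      ((P.map fun W : ι → X => (W i, W j)).prod μ) := by
    refine .of_bound hg.aestronglyMeasurable (C * C) (.of_forall fun q => ?_)
    rw [Real.norm_eq_abs, abs_mul]
    exact mul_le_mul (hC _ _) (hC _ _) (abs_nonneg _) ((abs_nonneg _).trans (hC q.1.1 q.1.2))
  calc ∫ W, h (W i) (W j) * h (W i) (W l) ∂P
      = ∫ q, h q.1.1 q.1.2 * h q.1.1 q.2 ∂(P.map fun W : ι → X => ((W i, W j), W l)) :=
        (integral_map (hmp.prodMk hml).aemeasurable hg.aestronglyMeasurable).symm
    _ = 0 := by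
        rw [hmap, hl, integral_prod _ hint]
        simp [integral_const_mul, h0]

/-- The sum over a batch of a centered bounded kernel has second moment at most `M * C ^ 2`. -/
theorem integral_sq_sum_le_of_centered {ι X : Type*} [Fintype ι] [MeasurableSpace X]
    (μ : Measure X) [IsProbabilityMeasure μ] {h : X → X → ℝ}
    (hm : Measurable (Function.uncurry h)) {C : ℝ} (hC : ∀ x y, |h x y| ≤ C)
    (h0 : ∀ x, ∫ y, h x y ∂μ = 0) (i : ι) :
    ∫ W, (∑ j, h (W i) (W j)) ^ 2 ∂(Measure.pi fun _ : ι => μ) ≤ Fintype.card ι * C ^ 2 := by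
  classical
  have hmW (a b : ι) : Measurable fun W : ι → X => h (W a) (W b) :=
    hm.comp (f := fun W : ι → X => (W a, W b))
      ((measurable_pi_apply a).prodMk (measurable_pi_apply b))
  have hb (j l : ι) (W : ι → X) : ‖h (W i) (W j) * h (W i) (W l)‖ ≤ C ^ 2 := by
    rw [Real.norm_eq_abs, abs_mul, sq]
    exact mul_le_mul (hC _ _) (hC _ _) (abs_nonneg _) ((abs_nonneg _).trans (hC (W i) (W j)))
  have hint (j l : ι) : Integrable (fun W : ι → X => h (W i) (W j) * h (W i) (W l))
      (Measure.pi fun _ : ι => μ) :=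
    .of_bound ((hmW i j).mul (hmW i l)).aestronglyMeasurable (C ^ 2) (.of_forall (hb j l))
  have hterm (j l : ι) : ∫ W, h (W i) (W j) * h (W i) (W l) ∂(Measure.pi fun _ : ι => μ) ≤
      if j = l then C ^ 2 else 0 := by
    split_ifs with hjl
    · refine (le_abs_self _).trans ?_
      simpa using norm_integral_le_of_norm_le_const (μ := Measure.pi fun _ : ι => μ)
        (.of_forall (hb j l))
    · rcases eq_or_ne i l with rfl | hil
      · have := integral_mul_eq_zero_of_centered μ hm hC h0 (Ne.symm hjl) (Ne.symm hjl)
        exact (integral_congr_ae (.of_forall fun W => mul_comm _ _)).trans this |>.le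
      · exact (integral_mul_eq_zero_of_centered μ hm hC h0 hil hjl).le
  simp_rw [sq (∑ j, h _ _), Finset.sum_mul_sum]
  rw [integral_finsetSum _ fun j _ => integrable_finsetSum _ fun l _ => hint j l]
  calc _ = ∑ j, ∑ l, ∫ W, h (W i) (W j) * h (W i) (W l) ∂(Measure.pi fun _ : ι => μ) :=
        Finset.sum_congr rfl fun j _ => integral_finsetSum _ fun l _ => hint j l
    _ ≤ ∑ j : ι, ∑ l : ι, if j = l then C ^ 2 else 0 :=
        Finset.sum_le_sum fun j _ => Finset.sum_le_sum fun l _ => hterm j l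
    _ = Fintype.card ι * C ^ 2 := by simp

theorem abs_log_sub_log_le {a b c : ℝ} (hc : 0 < c) (ha : c ≤ a) (hb : c ≤ b) :
    |Real.log a - Real.log b| ≤ c⁻¹ * |a - b| := by
  have key {x y : ℝ} (hx : c ≤ x) (hy : c ≤ y) : Real.log x - Real.log y ≤ c⁻¹ * |x - y| := by
    have hx0 := hc.trans_le hx
    have hy0 := hc.trans_le hy
    rw [← Real.log_div hx0.ne' hy0.ne']
    calc Real.log (x / y) ≤ x / y - 1 := Real.log_le_sub_one_of_pos (div_pos hx0 hy0)
      _ = y⁻¹ * (x - y) := by field_simp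
      _ ≤ y⁻¹ * |x - y| := by gcongr; exact le_abs_self _
      _ ≤ c⁻¹ * |x - y| := by gcongr
  rw [abs_le]
  have h1 := key ha hb
  have h2 := key hb ha
  rw [abs_sub_comm] at h2
  constructor <;> linarith

/-- The log of a sum of a kernel bounded away from `0` and `∞` is integrable. -/
theorem integrable_log_sum_kernel {X : Type*} [MeasurableSpace X]
    (μ : Measure X) [IsProbabilityMeasure μ] {k : X → X → ℝ}
    (hm : Measurable (Function.uncurry k)) {c C : ℝ} (hc : 0 < c) (hck : ∀ x y, c ≤ k x y)
    (hkC : ∀ x y, k x y ≤ C) {M : ℕ} (hM : 0 < M) (i : Fin M) :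
    Integrable (fun W : Fin M → X => Real.log (∑ j, k (W i) (W j)))
      (Measure.pi fun _ : Fin M => μ) := by
  have hM' : (0 : ℝ) < M := by exact_mod_cast hM
  have hmk (j : Fin M) : Measurable fun W : Fin M → X => k (W i) (W j) :=
    hm.comp (f := fun W : Fin M → X => (W i, W j))
      ((measurable_pi_apply i).prodMk (measurable_pi_apply j))
  refine .of_mem_Icc (Real.log (M * c)) (Real.log (M * C))
    (Real.measurable_log.comp (Finset.measurable_fun_sum _ fun j _ => hmk j)).aemeasurable
    (.of_forall fun W => ?_)
  have hlb : M * c ≤ ∑ j, k (W i) (W j) := by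
    simpa using Finset.sum_le_sum fun j (_ : j ∈ Finset.univ) => hck (W i) (W j)
  have hub : ∑ j, k (W i) (W j) ≤ M * C := by
    simpa using Finset.sum_le_sum fun j (_ : j ∈ Finset.univ) => hkC (W i) (W j)
  have h0 : 0 < M * c := by positivity
  exact ⟨Real.log_le_log h0 hlb, Real.log_le_log (h0.trans_le hlb) hub⟩

/-- Quantitative convergence of the logarithm of an empirical kernel mean. -/
theorem abs_integral_log_mean_sub_le {X : Type*} [MeasurableSpace X]
    (μ : Measure X) [IsProbabilityMeasure μ] {k : X → X → ℝ}
    (hm : Measurable (Function.uncurry k)) {c C : ℝ} (hc : 0 < c) (hck : ∀ x y, c ≤ k x y)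
    (hkC : ∀ x y, k x y ≤ C) {M : ℕ} (hM : 0 < M) (i : Fin M) :
    |(∫ W, Real.log (∑ j, k (W i) (W j)) ∂(Measure.pi fun _ : Fin M => μ)) - Real.log M -
      ∫ x, Real.log (∫ y, k x y ∂μ) ∂μ| ≤ c⁻¹ * ((C ^ 2 + 1) / 2) / √M := by
  set P := Measure.pi fun _ : Fin M => μ
  set m : X → ℝ := fun x => ∫ y, k x y ∂μ with hmdef
  have hM' : (0 : ℝ) < M := by exact_mod_cast hM
  have hs : 0 < √(M : ℝ) := Real.sqrt_pos.2 hM'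
  have hkx (x : X) : Integrable (k x) μ :=
    .of_bound (hm.comp measurable_prodMk_left).aestronglyMeasurable C (.of_forall fun y => by
      rw [Real.norm_eq_abs, abs_of_pos (hc.trans_le (hck x y))]; exact hkC x y)
  have hmm : Measurable m := hm.stronglyMeasurable.integral_prod_right.measurable
  have hcm (x : X) : c ≤ m x := by
    simpa using integral_mono (integrable_const c) (hkx x) (hck x)
  have hmC (x : X) : m x ≤ C := by
    simpa using integral_mono (hkx x) (integrable_const C) (hkC x)
  have hcent (x : X) : ∫ y, (k x y - m x) ∂μ = 0 := by
    rw [integral_sub (hkx x) (integrable_const _)]; simp [hmdef]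
  have hbd (x y : X) : |k x y - m x| ≤ C := by
    rw [abs_le]
    constructor <;> linarith [hck x y, hkC x y, hcm x, hmC x]
  have hmh : Measurable (Function.uncurry fun x y => k x y - m x) :=
    hm.sub (hmm.comp measurable_fst)
  have hsq := integral_sq_sum_le_of_centered μ hmh hbd hcent i
  rw [Fintype.card_fin] at hsq
  set D : (Fin M → X) → ℝ := fun W => ∑ j, (k (W i) (W j) - m (W i)) with hD
  have hmk (j : Fin M) : Measurable fun W : Fin M → X => k (W i) (W j) :=
    hm.comp (f := fun W : Fin M → X => (W i, W j))
      ((measurable_pi_apply i).prodMk (measurable_pi_apply j))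
  have hmi : Measurable fun W : Fin M → X => m (W i) := hmm.comp (measurable_pi_apply i)
  have hmD : Measurable D := Finset.measurable_fun_sum _ fun j _ => (hmk j).sub hmi
  have hDb (W : Fin M → X) : |D W| ≤ M * C := by
    refine (Finset.abs_sum_le_sum_abs _ _).trans ?_
    refine (Finset.sum_le_sum fun j _ => hbd (W i) (W j)).trans ?_
    simp
  have hDi : Integrable (fun W => D W ^ 2) P :=
    .of_bound (hmD.pow_const 2).aestronglyMeasurable ((M * C) ^ 2) (.of_forall fun W => by
      rw [Real.norm_eq_abs, abs_pow]; exact pow_le_pow_left₀ (abs_nonneg _) (hDb W) 2)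
  have hsum_lb (W : Fin M → X) : M * c ≤ ∑ j, k (W i) (W j) := by
    simpa using Finset.sum_le_sum fun j (_ : j ∈ Finset.univ) => hck (W i) (W j)
  have hlogi : Integrable (fun W : Fin M → X => Real.log (∑ j, k (W i) (W j))) P :=
    integrable_log_sum_kernel μ hm hc hck hkC hM i
  have hlogm : Integrable (fun W : Fin M → X => Real.log (m (W i))) P :=
    .of_mem_Icc (Real.log c) (Real.log C) (Real.measurable_log.comp hmi).aemeasurable
      (.of_forall fun W => ⟨Real.log_le_log hc (hcm _),
        Real.log_le_log (hc.trans_le (hcm _)) (hmC _)⟩)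
  have htarget : ∫ x, Real.log (m x) ∂μ = ∫ W, Real.log (m (W i)) ∂P :=
    (integral_comp_eval (μ := fun _ : Fin M => μ) (i := i)
      (Real.measurable_log.comp hmm).aestronglyMeasurable).symm
  have hpt (W : Fin M → X) :
      |Real.log (∑ j, k (W i) (W j)) - Real.log M - Real.log (m (W i))| ≤
        c⁻¹ * ((D W ^ 2 / M + 1) / (2 * √M)) := by
    have hS : 0 < ∑ j, k (W i) (W j) := (by positivity : 0 < M * c).trans_le (hsum_lb W)
    rw [← Real.log_div hS.ne' hM'.ne']
    refine (abs_log_sub_log_le hc ((le_div_iff₀ hM').2 (by linarith [hsum_lb W]))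
      (hcm _)).trans ?_
    gcongr
    have hDe : (∑ j, k (W i) (W j)) / M - m (W i) = D W / M := by
      simp only [hD, Finset.sum_sub_distrib, Finset.sum_const, Finset.card_univ,
        Fintype.card_fin, nsmul_eq_mul]
      field_simp
    have amgm (a : ℝ) {r : ℝ} (hr : 0 < r) : a / r ^ 2 ≤ (a ^ 2 / r ^ 2 + 1) / (2 * r) := by
      have : (a ^ 2 / r ^ 2 + 1) / (2 * r) - a / r ^ 2 = (a - r) ^ 2 / (2 * r ^ 3) := by
        field_simp
        ring
      have : 0 ≤ (a - r) ^ 2 / (2 * r ^ 3) := by positivity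
      linarith
    have h := amgm |D W| hs
    rwa [Real.sq_sqrt hM'.le, sq_abs, ← abs_of_pos hM', ← abs_div, ← hDe, abs_of_pos hM'] at h
  have hdiff : (∫ W, Real.log (∑ j, k (W i) (W j)) ∂P) - Real.log M - ∫ x, Real.log (m x) ∂μ =
      ∫ W, (Real.log (∑ j, k (W i) (W j)) - Real.log M - Real.log (m (W i))) ∂P := by
    have h1 : Integrable (fun W : Fin M → X => Real.log (∑ j, k (W i) (W j)) - Real.log M) P :=
      hlogi.sub (integrable_const _)
    rw [htarget, integral_sub h1 hlogm, integral_sub hlogi (integrable_const _)]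
    simp
  rw [hdiff, ← Real.norm_eq_abs]
  have hRi : Integrable (fun W => c⁻¹ * ((D W ^ 2 / M + 1) / (2 * √M))) P :=
    (((hDi.div_const _).add (integrable_const _)).div_const _).const_mul _
  refine (norm_integral_le_of_norm_le hRi (.of_forall fun W => hpt W)).trans ?_
  rw [integral_const_mul, integral_div, integral_add (hDi.div_const _) (integrable_const _),
    integral_div]
  rw [mul_div_assoc, div_div]
  gcongr
  · rw [div_le_iff₀ hM']; linarith
  · simp

/-- Convergence rate for the mean over the batch of a bounded term plus the log of the kernel sum. -/
theorem abs_integral_mean_add_log_sub_le {X : Type*} [MeasurableSpace X]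
    (μ : Measure X) [IsProbabilityMeasure μ] {s : X → ℝ} (hs : Measurable s) {a b : ℝ}
    (hsI : ∀ x, s x ∈ Set.Icc a b) {k : X → X → ℝ}
    (hm : Measurable (Function.uncurry k)) {c C : ℝ} (hc : 0 < c) (hck : ∀ x y, c ≤ k x y)
    (hkC : ∀ x y, k x y ≤ C) {M : ℕ} (hM : 0 < M) :
    |(∫ W, (1 / (M : ℝ)) * ∑ i, (s (W i) + Real.log (∑ j, k (W i) (W j)))
        ∂(Measure.pi fun _ : Fin M => μ)) - Real.log M -
      (∫ x, s x ∂μ + ∫ x, Real.log (∫ y, k x y ∂μ) ∂μ)| ≤ c⁻¹ * ((C ^ 2 + 1) / 2) / √M := by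
  set P := Measure.pi fun _ : Fin M => μ
  have hM' : (0 : ℝ) < M := by exact_mod_cast hM
  have hsi (i : Fin M) : Integrable (fun W : Fin M → X => s (W i)) P :=
    .of_mem_Icc a b (hs.comp (measurable_pi_apply i)).aemeasurable (.of_forall fun W => hsI (W i))
  have hli (i : Fin M) : Integrable (fun W : Fin M → X => Real.log (∑ j, k (W i) (W j))) P :=
    integrable_log_sum_kernel μ hm hc hck hkC hM i
  have hSi (i : Fin M) : ∫ W, s (W i) ∂P = ∫ x, s x ∂μ :=
    integral_comp_eval (μ := fun _ : Fin M => μ) (i := i) hs.aestronglyMeasurable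
  have hcomb : (∫ W, (1 / (M : ℝ)) * ∑ i, (s (W i) + Real.log (∑ j, k (W i) (W j))) ∂P) -
      Real.log M - (∫ x, s x ∂μ + ∫ x, Real.log (∫ y, k x y ∂μ) ∂μ) =
      (1 / (M : ℝ)) * ∑ i : Fin M, ((∫ W, Real.log (∑ j, k (W i) (W j)) ∂P) - Real.log M -
        ∫ x, Real.log (∫ y, k x y ∂μ) ∂μ) := by
    have hadd (i : Fin M) : Integrable
        (fun W : Fin M → X => s (W i) + Real.log (∑ j, k (W i) (W j))) P := (hsi i).add (hli i)
    rw [integral_const_mul, integral_finsetSum _ fun i _ => hadd i]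
    simp_rw [integral_add (hsi _) (hli _), hSi]
    simp only [Finset.sum_add_distrib, Finset.sum_sub_distrib, Finset.sum_const,
      Finset.card_univ, Fintype.card_fin, nsmul_eq_mul]
    field_simp
    ring
  rw [hcomb, abs_mul, abs_of_pos (by positivity)]
  calc _ ≤ (1 / (M : ℝ)) * ∑ _i : Fin M, c⁻¹ * ((C ^ 2 + 1) / 2) / √M := by
        gcongr
        exact (Finset.abs_sum_le_sum_abs _ _).trans (Finset.sum_le_sum fun i _ =>
          abs_integral_log_mean_sub_le μ hm hc hck hkC hM i)
    _ = c⁻¹ * ((C ^ 2 + 1) / 2) / √M := by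
        simp only [Finset.sum_const, Finset.card_univ, Fintype.card_fin, nsmul_eq_mul]
        field_simp

theorem tendsto_log_natCast_sub_log_sub_one :
    Tendsto (fun M : ℕ => Real.log M - Real.log ((M : ℝ) - 1)) atTop (nhds 0) := by
  have h : Tendsto (fun x : ℝ => Real.log (x + 1) - Real.log x) atTop (nhds 0) :=
    Real.tendsto_log_comp_add_sub_log 1
  have h2 : Tendsto (fun M : ℕ => (M : ℝ) - 1) atTop atTop :=
    tendsto_atTop_add_const_right _ _ tendsto_natCast_atTop_atTop
  simpa [Function.comp_def] using h.comp h2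

theorem exp_inner_div_mem_Icc {d : ℕ} {τ : ℝ} (hτ : 0 < τ) (x y : Sph d) :
    Real.exp (⟪(x : EuclideanSpace ℝ (Fin d)), (y : EuclideanSpace ℝ (Fin d))⟫ / τ) ∈
      Set.Icc (Real.exp (-1 / τ)) (Real.exp (1 / τ)) := by
  have h := abs_le.1 (abs_real_inner_le_norm (x : EuclideanSpace ℝ (Fin d)) y)
  rw [norm_eq_of_mem_sphere, norm_eq_of_mem_sphere, one_mul] at h
  constructor <;> gcongr <;> linarith [h.1, h.2]

theorem LnceBatch_eq {d M : ℕ} (hM : 0 < M) (τ : ℝ) (W : Fin M → Sph d × Sph d) :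
    LnceBatch d M τ W = (1 / (M : ℝ)) * ∑ i,
      (-(⟪((W i).1 : EuclideanSpace ℝ (Fin d)), ((W i).2 : EuclideanSpace ℝ (Fin d))⟫ / τ) +
        Real.log (∑ j, Real.exp (⟪((W i).1 : EuclideanSpace ℝ (Fin d)),
          ((W j).2 : EuclideanSpace ℝ (Fin d))⟫ / τ))) := by
  have : Nonempty (Fin M) := ⟨⟨0, hM⟩⟩
  unfold LnceBatch
  congr 1
  refine Finset.sum_congr rfl fun i _ => ?_
  rw [Real.log_div (Real.exp_ne_zero _)
    (Finset.sum_pos (fun j _ => Real.exp_pos _) Finset.univ_nonempty).ne', Real.log_exp]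
  ring

theorem stmt_10 (d : ℕ) (τ : ℝ) (hτ : 0 < τ)
    (μ : Measure (Sph d × Sph d)) [IsProbabilityMeasure μ]
    (p : Measure (Sph d))
    (hp1 : μ.map Prod.fst = p) (hp2 : μ.map Prod.snd = p) :
    Tendsto
      (fun M : ℕ =>
        (∫ W, LnceBatch d M τ W ∂(Measure.pi fun _ : Fin M => μ)) -
          Real.log ((M : ℝ) - 1))
      atTop
      (nhds
        ((∫ z, -(⟪(z.1 : EuclideanSpace ℝ (Fin d)), (z.2 : EuclideanSpace ℝ (Fin d))⟫ / τ) ∂μ) +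
          ∫ u', Real.log
              (∫ u, Real.exp (⟪(u : EuclideanSpace ℝ (Fin d)),
                  (u' : EuclideanSpace ℝ (Fin d))⟫ / τ) ∂p) ∂p)) := by
  have hc1 : Continuous fun q : Sph d × Sph d =>
      ⟪(q.1 : EuclideanSpace ℝ (Fin d)), (q.2 : EuclideanSpace ℝ (Fin d))⟫ / τ := by fun_prop
  set s : Sph d × Sph d → ℝ := fun z =>
    ⟪(z.1 : EuclideanSpace ℝ (Fin d)), (z.2 : EuclideanSpace ℝ (Fin d))⟫ / τ with hs
  set k : Sph d × Sph d → Sph d × Sph d → ℝ := fun x y => Real.exp (s (x.1, y.2)) with hk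
  have hkm : Measurable (Function.uncurry k) :=
    (Real.continuous_exp.comp (hc1.comp
      ((continuous_fst.comp continuous_fst).prodMk
        (continuous_snd.comp continuous_snd)))).measurable
  have hkI (x y) : k x y ∈ Set.Icc (Real.exp (-1 / τ)) (Real.exp (1 / τ)) :=
    exp_inner_div_mem_Icc hτ x.1 y.2
  have hlimit : ∫ u', Real.log (∫ u, Real.exp (⟪(u : EuclideanSpace ℝ (Fin d)),
      (u' : EuclideanSpace ℝ (Fin d))⟫ / τ) ∂p) ∂p = ∫ x, Real.log (∫ y, k x y ∂μ) ∂μ := by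
    have hinner (u' : Sph d) : ∫ u, Real.exp (⟪(u : EuclideanSpace ℝ (Fin d)),
        (u' : EuclideanSpace ℝ (Fin d))⟫ / τ) ∂p = ∫ y, Real.exp (s (u', y.2)) ∂μ := by
      rw [← hp2, integral_map measurable_snd.aemeasurable
        (Continuous.aestronglyMeasurable (by fun_prop))]
      simp_rw [hs, real_inner_comm]
    simp_rw [hinner]
    rw [← hp1, integral_map measurable_fst.aemeasurable]
    refine (Real.measurable_log.comp ?_).aestronglyMeasurable
    exact (StronglyMeasurable.integral_prod_right
      (f := fun (u : Sph d) (y : Sph d × Sph d) => Real.exp (s (u, y.2)))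
      (Real.continuous_exp.comp (hc1.comp (continuous_fst.prodMk
        (continuous_snd.comp continuous_snd)))).measurable.stronglyMeasurable).measurable
  set G := ∫ x, Real.log (∫ y, k x y ∂μ) ∂μ with hG
  set S := ∫ z, -(s z) ∂μ with hS
  set K : ℝ := (Real.exp (-1 / τ))⁻¹ * ((Real.exp (1 / τ) ^ 2 + 1) / 2) with hK
  have hsI (z : Sph d × Sph d) : -(s z) ∈ Set.Icc (-(1 / τ)) (-(-1 / τ)) :=
    have h := hkI z z
    ⟨neg_le_neg (Real.exp_le_exp.1 h.2), neg_le_neg (Real.exp_le_exp.1 h.1)⟩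
  have hbound (M : ℕ) (hM : 0 < M) :
      |(∫ W, LnceBatch d M τ W ∂(Measure.pi fun _ : Fin M => μ)) - Real.log M - (S + G)| ≤
        K / √M := by
    simp_rw [LnceBatch_eq hM]
    exact abs_integral_mean_add_log_sub_le μ hc1.measurable.neg hsI hkm (Real.exp_pos _)
      (fun x y => (hkI x y).1) (fun x y => (hkI x y).2) hM
  have hK0 : Tendsto (fun M : ℕ => K / √(M : ℝ)) atTop (nhds 0) :=
    (Real.tendsto_sqrt_atTop.comp tendsto_natCast_atTop_atTop).const_div_atTop K
  have h0 : Tendsto (fun M : ℕ => (∫ W, LnceBatch d M τ W ∂(Measure.pi fun _ : Fin M => μ)) -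
      Real.log M - (S + G)) atTop (nhds 0) :=
    squeeze_zero_norm' (eventually_atTop.2 ⟨1, fun M hM => hbound M hM⟩) hK0
  rw [hlimit]
  have := (h0.add tendsto_log_natCast_sub_log_sub_one).add_const (S + G)
  simp only [add_zero, zero_add] at this
  exact this.congr fun M => by ring
end
end

section
/- Let τ > 0 and let μ be a Borel probability measure on S^{d−1} × S^{d−1} with both marginals equal to p. For M ≥ 2 define the mini-batch DHEL loss L_M(U,V) = (1/M) Σ_{i=1}^M −log( exp(u_i·v_i/τ) / Σ_{j≠i} exp(u_i·u_j/τ) ). Then as M → ∞, the expectation over an i.i.d. sample ((u_1,v_1),…,(u_M,v_M)) ∼ μ^M of L_M, minus log(M−1), converges to E_{(u,v)∼μ}[ −u·v/τ ] + E_{u′∼p}[ log E_{u∼p}[ exp(u·u′/τ) ] ]. -/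
open scoped BigOperators RealInnerProductSpace
open MeasureTheory Filter

noncomputable section

/-- Mini-batch DHEL loss with temperature `τ` evaluated on a batch `W` of `M` positive
pairs of points of the sphere: the normalising denominator for `uᵢ` sums
`exp(⟪uᵢ, uⱼ⟫/τ)` over the other elements of the same view only. -/
def LdhelBatch (d M : ℕ) (τ : ℝ) (W : Fin M → Sph d × Sph d) : ℝ :=
  (1 / (M : ℝ)) * ∑ i, -Real.log
    (Real.exp (⟪((W i).1 : EuclideanSpace ℝ (Fin d)),
        ((W i).2 : EuclideanSpace ℝ (Fin d))⟫ / τ) /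
      ∑ j ∈ Finset.univ.erase i,
        Real.exp (⟪((W i).1 : EuclideanSpace ℝ (Fin d)),
          ((W j).1 : EuclideanSpace ℝ (Fin d))⟫ / τ))

section UStatistic

variable {X : Type*} [MeasurableSpace X]

lemma abs_log_sub_log_le_s11 {a x y : ℝ} (ha : 0 < a) (hx : a ≤ x) (hy : a ≤ y) :
    |Real.log x - Real.log y| ≤ |x - y| / a := by
  have key : ∀ s t : ℝ, a ≤ s → a ≤ t → Real.log s - Real.log t ≤ |s - t| / a := by
    intro s t hs ht
    have hs0 : 0 < s := ha.trans_le hs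
    have ht0 : 0 < t := ha.trans_le ht
    calc Real.log s - Real.log t = Real.log (s / t) := (Real.log_div hs0.ne' ht0.ne').symm
      _ ≤ s / t - 1 := Real.log_le_sub_one_of_pos (div_pos hs0 ht0)
      _ = (s - t) / t := by field_simp
      _ ≤ |s - t| / t := by gcongr; exact le_abs_self _
      _ ≤ |s - t| / a := by gcongr
  refine abs_sub_le_iff.2 ⟨key x y hx hy, ?_⟩
  rw [abs_sub_comm]
  exact key y x hy hx

lemma integrable_of_measurable_of_abs_le {μ : Measure X} [IsFiniteMeasure μ] {f : X → ℝ}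
    (hf : Measurable f) {C : ℝ} (hC : ∀ x, |f x| ≤ C) : Integrable f μ :=
  Integrable.of_bound hf.aestronglyMeasurable C (Eventually.of_forall hC)

lemma measurable_uncurry_eval {ι : Type*} {h : X → X → ℝ} (hm : Measurable (Function.uncurry h))
    (i j : ι) : Measurable fun W : ι → X => h (W i) (W j) :=
  hm.comp (g := Function.uncurry h) (f := fun W : ι → X => (W i, W j))
    ((measurable_pi_apply i).prodMk (measurable_pi_apply j))

variable {μ : Measure X} [IsProbabilityMeasure μ] {M : ℕ}

lemma integral_pi_mul_eq_zero {h : X → X → ℝ} (hm : Measurable (Function.uncurry h)) {C : ℝ}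
    (hC : ∀ x y, |h x y| ≤ C) (h0 : ∀ x, ∫ y, h x y ∂μ = 0) {i j l : Fin M}
    (hij : i ≠ j) (hlj : l ≠ j) :
    ∫ W, h (W i) (W j) * h (W i) (W l) ∂(Measure.pi fun _ : Fin M => μ) = 0 := by
  set P := Measure.pi fun _ : Fin M => μ
  have hind : ProbabilityTheory.iIndepFun (fun (k : Fin M) (W : Fin M → X) => W k) P :=
    ProbabilityTheory.iIndepFun_pi (X := fun _ x => x) fun _ => aemeasurable_id
  have hpair := hind.indepFun_prodMk (fun k => measurable_pi_apply k) i l j hij hlj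
  have hil : Measurable fun W : Fin M → X => (W i, W l) := by fun_prop
  have hj : Measurable fun W : Fin M → X => W j := by fun_prop
  rw [ProbabilityTheory.indepFun_iff_map_prod_eq_prod_map_map hil.aemeasurable hj.aemeasurable,
    (measurePreserving_eval (fun _ : Fin M => μ) j).map_eq] at hpair
  have : IsProbabilityMeasure (P.map fun W => (W i, W l)) :=
    Measure.isProbabilityMeasure_map hil.aemeasurable
  have hF : Measurable fun q : (X × X) × X => h q.1.1 q.2 * h q.1.1 q.1.2 :=
    (hm.comp (measurable_fst.fst.prodMk measurable_snd)).mul (hm.comp measurable_fst)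
  have hmap := integral_map (μ := P) (hil.prodMk hj).aemeasurable hF.aestronglyMeasurable
  rw [hpair, integral_prod] at hmap
  · rw [← hmap]
    simp only [integral_mul_const, h0, zero_mul, integral_zero]
  · refine integrable_of_measurable_of_abs_le hF (C := C * C) fun q => ?_
    rw [abs_mul]
    exact mul_le_mul (hC _ _) (hC _ _) (abs_nonneg _) ((abs_nonneg _).trans (hC q.1.1 q.2))

lemma integral_pi_sq_sum_erase_le {h : X → X → ℝ} (hm : Measurable (Function.uncurry h)) {C : ℝ}
    (hC : ∀ x y, |h x y| ≤ C) (h0 : ∀ x, ∫ y, h x y ∂μ = 0) (i : Fin M) :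
    ∫ W, (∑ j ∈ Finset.univ.erase i, h (W i) (W j)) ^ 2 ∂(Measure.pi fun _ : Fin M => μ) ≤
      ((M : ℝ) - 1) * C ^ 2 := by
  have hmeas : ∀ j, Measurable fun W : Fin M → X => h (W i) (W j) := fun j =>
    measurable_uncurry_eval hm i j
  have hbd : ∀ j l (W : Fin M → X), |h (W i) (W j) * h (W i) (W l)| ≤ C ^ 2 := by
    intro j l W
    rw [abs_mul, sq]
    exact mul_le_mul (hC _ _) (hC _ _) (abs_nonneg _) ((abs_nonneg _).trans (hC (W i) (W j)))
  have hint : ∀ j l, Integrable (fun W : Fin M → X => h (W i) (W j) * h (W i) (W l))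
      (Measure.pi fun _ : Fin M => μ) := fun j l =>
    integrable_of_measurable_of_abs_le ((hmeas j).mul (hmeas l)) (hbd j l)
  simp_rw [sq (∑ j ∈ Finset.univ.erase i, _), Finset.sum_mul_sum]
  rw [integral_finsetSum _ fun j _ => integrable_finsetSum _ fun l _ => hint j l]
  have hM : 1 ≤ M := i.pos
  calc ∑ j ∈ Finset.univ.erase i, ∫ W, ∑ l ∈ Finset.univ.erase i,
        h (W i) (W j) * h (W i) (W l) ∂(Measure.pi fun _ : Fin M => μ)
      ≤ ∑ j ∈ Finset.univ.erase i, C ^ 2 := by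
        refine Finset.sum_le_sum fun j hj => ?_
        rw [integral_finsetSum _ fun l _ => hint j l, Finset.sum_eq_single_of_mem j hj]
        · calc ∫ W, h (W i) (W j) * h (W i) (W j) ∂(Measure.pi fun _ : Fin M => μ)
              ≤ ∫ _, C ^ 2 ∂(Measure.pi fun _ : Fin M => μ) :=
                integral_mono (hint j j) (integrable_const _) fun W =>
                  (le_abs_self _).trans (hbd j j W)
            _ = C ^ 2 := by simp
        · intro l _ hlj
          exact integral_pi_mul_eq_zero hm hC h0 (Finset.ne_of_mem_erase hj).symm hlj
    _ = ((M : ℝ) - 1) * C ^ 2 := by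
        rw [Finset.sum_const, Finset.card_erase_of_mem (Finset.mem_univ i), Finset.card_univ,
          Fintype.card_fin, nsmul_eq_mul, Nat.cast_sub hM, Nat.cast_one]

lemma integral_pi_abs_average_erase_le {h : X → X → ℝ} (hm : Measurable (Function.uncurry h))
    {C : ℝ} (hC : ∀ x y, |h x y| ≤ C) (h0 : ∀ x, ∫ y, h x y ∂μ = 0) (hM : 2 ≤ M) (i : Fin M) :
    ∫ W, |(∑ j ∈ Finset.univ.erase i, h (W i) (W j)) / ((M : ℝ) - 1)|
        ∂(Measure.pi fun _ : Fin M => μ) ≤ (C ^ 2 + 1) / 2 / √((M : ℝ) - 1) := by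
  have hM' : (2 : ℝ) ≤ M := by exact_mod_cast hM
  set s := √((M : ℝ) - 1) with hs
  have hs0 : 0 < s := Real.sqrt_pos.2 (by linarith)
  have hs2 : (M : ℝ) - 1 = s ^ 2 := (Real.sq_sqrt (by linarith)).symm
  have hmeas : Measurable fun W : Fin M → X => ∑ j ∈ Finset.univ.erase i, h (W i) (W j) :=
    Finset.measurable_fun_sum _ fun j _ =>
      measurable_uncurry_eval hm i j
  have hbd : ∀ W : Fin M → X,
      |∑ j ∈ Finset.univ.erase i, h (W i) (W j)| ≤ ∑ j ∈ Finset.univ.erase i, C := fun W =>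
    (Finset.abs_sum_le_sum_abs _ _).trans (Finset.sum_le_sum fun j _ => hC _ _)
  have hint : Integrable (fun W : Fin M → X => ∑ j ∈ Finset.univ.erase i, h (W i) (W j))
      (Measure.pi fun _ : Fin M => μ) := integrable_of_measurable_of_abs_le hmeas hbd
  have hint2 : Integrable (fun W : Fin M → X => (∑ j ∈ Finset.univ.erase i, h (W i) (W j)) ^ 2)
      (Measure.pi fun _ : Fin M => μ) :=
    integrable_of_measurable_of_abs_le (hmeas.pow_const 2) fun W => by
      rw [abs_pow]
      exact pow_le_pow_left₀ (abs_nonneg _) (hbd W) 2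
  have hpt : ∀ t : ℝ, |t / s ^ 2| ≤ t ^ 2 * (1 / (2 * s ^ 3)) + 1 / (2 * s) := by
    intro t
    rw [abs_div, abs_of_pos (by positivity : 0 < s ^ 2)]
    have h1 : t ^ 2 * (1 / (2 * s ^ 3)) + 1 / (2 * s) - |t| / s ^ 2 =
        (|t| - s) ^ 2 / (2 * s ^ 3) := by
      rw [← sq_abs t]
      field_simp
      ring
    have h2 : 0 ≤ (|t| - s) ^ 2 / (2 * s ^ 3) := by positivity
    linarith
  calc ∫ W, |(∑ j ∈ Finset.univ.erase i, h (W i) (W j)) / ((M : ℝ) - 1)|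
        ∂(Measure.pi fun _ : Fin M => μ)
      ≤ ∫ W, ((∑ j ∈ Finset.univ.erase i, h (W i) (W j)) ^ 2 * (1 / (2 * s ^ 3)) + 1 / (2 * s))
          ∂(Measure.pi fun _ : Fin M => μ) := by
        refine integral_mono (hint.div_const _).abs
          ((hint2.mul_const _).add (integrable_const _)) fun W => ?_
        simp only [hs2]
        exact hpt _
    _ = (∫ W, (∑ j ∈ Finset.univ.erase i, h (W i) (W j)) ^ 2
          ∂(Measure.pi fun _ : Fin M => μ)) * (1 / (2 * s ^ 3)) + 1 / (2 * s) := by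
        rw [integral_add (hint2.mul_const _) (integrable_const _), integral_mul_const]
        simp
    _ ≤ (s ^ 2 * C ^ 2) * (1 / (2 * s ^ 3)) + 1 / (2 * s) := by
        have := integral_pi_sq_sum_erase_le hm hC h0 i
        rw [hs2] at this
        gcongr
    _ = (C ^ 2 + 1) / 2 / s := by
        field_simp

lemma abs_integral_pi_log_sum_erase_sub_le {K : X → X → ℝ}
    (hm : Measurable (Function.uncurry K)) {a b : ℝ} (ha : 0 < a) (hKa : ∀ x y, a ≤ K x y)
    (hKb : ∀ x y, K x y ≤ b) (hM : 2 ≤ M) (i : Fin M) :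
    Integrable (fun W : Fin M → X => Real.log (∑ j ∈ Finset.univ.erase i, K (W i) (W j)))
        (Measure.pi fun _ : Fin M => μ) ∧
      |∫ W, Real.log (∑ j ∈ Finset.univ.erase i, K (W i) (W j))
            ∂(Measure.pi fun _ : Fin M => μ) -
          Real.log ((M : ℝ) - 1) - ∫ x, Real.log (∫ y, K x y ∂μ) ∂μ| ≤
        ((b - a) ^ 2 + 1) / 2 / √((M : ℝ) - 1) / a := by
  have hM' : (2 : ℝ) ≤ M := by exact_mod_cast hM
  have hM1 : (0 : ℝ) < M - 1 := by linarith
  set g : X → ℝ := fun x => ∫ y, K x y ∂μ with hg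
  have hgm : Measurable g := hm.stronglyMeasurable.integral_prod_right.measurable
  have hKint : ∀ x, Integrable (K x) μ := fun x =>
    integrable_of_measurable_of_abs_le (hm.comp measurable_prodMk_left) fun y =>
      (abs_of_pos (ha.trans_le (hKa x y))).le.trans (hKb x y)
  have hga : ∀ x, a ≤ g x := fun x => by
    simpa using integral_mono (integrable_const a) (hKint x) (hKa x)
  have hgb : ∀ x, g x ≤ b := fun x => by
    simpa using integral_mono (hKint x) (integrable_const b) (hKb x)
  have hlog_int : ∀ {Y : Type _} [MeasurableSpace Y] (ν : Measure Y) [IsProbabilityMeasure ν]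
      (f : Y → ℝ), Measurable f → (∀ y, a ≤ f y) → (∀ y, f y ≤ b) →
      Integrable (fun y => Real.log (f y)) ν := by
    intro Y _ ν _ f hf hfa hfb
    refine integrable_of_measurable_of_abs_le hf.log (C := max |Real.log a| |Real.log b|)
      fun y => abs_le_max_abs_abs (Real.log_le_log ha (hfa y))
        (Real.log_le_log (ha.trans_le (hfa y)) (hfb y))
  set S : (Fin M → X) → ℝ := fun W => ∑ j ∈ Finset.univ.erase i, K (W i) (W j) with hS
  have hcard : ((Finset.univ.erase i).card : ℝ) = M - 1 := by
    rw [Finset.card_erase_of_mem (Finset.mem_univ i), Finset.card_univ,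
      Fintype.card_fin, Nat.cast_sub i.pos, Nat.cast_one]
  have hSm : Measurable S := Finset.measurable_fun_sum _ fun j _ =>
    measurable_uncurry_eval hm i j
  have hSa : ∀ W, a ≤ S W / (M - 1) := fun W => by
    rw [le_div_iff₀ hM1, mul_comm, ← hcard, ← nsmul_eq_mul]
    exact Finset.card_nsmul_le_sum _ _ _ fun j _ => hKa _ _
  have hSb : ∀ W, S W / (M - 1) ≤ b := fun W => by
    rw [div_le_iff₀ hM1, mul_comm, ← hcard, ← nsmul_eq_mul]
    exact Finset.sum_le_card_nsmul _ _ _ fun j _ => hKb _ _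
  have hlog : ∀ W, Real.log (S W) = Real.log (S W / (M - 1)) + Real.log ((M : ℝ) - 1) := fun W => by
    have : S W / (M - 1) ≠ 0 := (ha.trans_le (hSa W)).ne'
    rw [← Real.log_mul this hM1.ne', div_mul_cancel₀ _ hM1.ne']
  have hI1 := hlog_int (Measure.pi fun _ : Fin M => μ) _ (hSm.div_const ((M : ℝ) - 1)) hSa hSb
  have hI2 : Integrable (fun W : Fin M → X => Real.log (g (W i)))
      (Measure.pi fun _ : Fin M => μ) :=
    hlog_int _ _ (hgm.comp (measurable_pi_apply i)) (fun _ => hga _) fun _ => hgb _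
  have hgi : ∫ W, Real.log (g (W i)) ∂(Measure.pi fun _ : Fin M => μ) = ∫ x, Real.log (g x) ∂μ := by
    have hmp := measurePreserving_eval (fun _ : Fin M => μ) i
    have := integral_map (μ := Measure.pi fun _ : Fin M => μ) hmp.measurable.aemeasurable
      hgm.log.aestronglyMeasurable
    rw [hmp.map_eq] at this
    exact this.symm
  have hhm : Measurable (Function.uncurry fun x y => K x y - g x) :=
    hm.sub (hgm.comp measurable_fst)
  have hhC : ∀ x y, |K x y - g x| ≤ b - a := fun x y =>
    abs_sub_le_iff.2 ⟨by linarith [hKb x y, hga x], by linarith [hKa x y, hgb x]⟩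
  have hh0 : ∀ x, ∫ y, (K x y - g x) ∂μ = 0 := fun x => by
    rw [integral_sub (hKint x) (integrable_const _)]
    simp [hg]
  have hdev : ∀ W : Fin M → X,
      (∑ j ∈ Finset.univ.erase i, (K (W i) (W j) - g (W i))) / ((M : ℝ) - 1) =
        S W / (M - 1) - g (W i) := fun W => by
    rw [Finset.sum_sub_distrib, Finset.sum_const, nsmul_eq_mul, hcard]
    field_simp
    rfl
  have hmain := integral_pi_abs_average_erase_le hhm hhC hh0 hM i
  simp only [hdev] at hmain
  have hdi : Integrable (fun W : Fin M → X => S W / (M - 1) - g (W i))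
      (Measure.pi fun _ : Fin M => μ) :=
    integrable_of_measurable_of_abs_le
      ((hSm.div_const _).sub (hgm.comp (measurable_pi_apply i))) (C := b - a) fun W =>
      abs_sub_le_iff.2 ⟨by linarith [hSb W, hga (W i)], by linarith [hSa W, hgb (W i)]⟩
  have hlog' : (fun W : Fin M → X => Real.log (∑ j ∈ Finset.univ.erase i, K (W i) (W j))) =
      fun W => Real.log (S W / (M - 1)) + Real.log ((M : ℝ) - 1) := funext hlog
  rw [hlog']
  refine ⟨hI1.add (integrable_const _), ?_⟩
  rw [integral_add hI1 (integrable_const _), ← hgi]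
  simp only [integral_const, probReal_univ, one_smul, add_sub_cancel_right]
  rw [← integral_sub hI1 hI2]
  calc |∫ W, (Real.log (S W / (M - 1)) - Real.log (g (W i))) ∂(Measure.pi fun _ : Fin M => μ)|
      ≤ ∫ W, |Real.log (S W / (M - 1)) - Real.log (g (W i))| ∂(Measure.pi fun _ : Fin M => μ) :=
        abs_integral_le_integral_abs
    _ ≤ ∫ W, |S W / (M - 1) - g (W i)| / a ∂(Measure.pi fun _ : Fin M => μ) :=
        integral_mono (hI1.sub hI2).abs (hdi.abs.div_const a) fun W =>
          abs_log_sub_log_le_s11 ha (hSa W) (hga _)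
    _ ≤ ((b - a) ^ 2 + 1) / 2 / √((M : ℝ) - 1) / a := by
        rw [integral_div]
        gcongr

theorem tendsto_integral_pi_average_log_sum_erase {A : X → ℝ} (hA : Measurable A)
    (hAi : Integrable A μ) {K : X → X → ℝ} (hm : Measurable (Function.uncurry K)) {a b : ℝ}
    (ha : 0 < a) (hKa : ∀ x y, a ≤ K x y) (hKb : ∀ x y, K x y ≤ b) :
    Tendsto
      (fun M : ℕ =>
        (∫ W, (1 / (M : ℝ)) * ∑ i,
            (A (W i) + Real.log (∑ j ∈ Finset.univ.erase i, K (W i) (W j)))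
          ∂(Measure.pi fun _ : Fin M => μ)) - Real.log ((M : ℝ) - 1))
      atTop (nhds ((∫ x, A x ∂μ) + ∫ x, Real.log (∫ y, K x y ∂μ) ∂μ)) := by
  have hrate : Tendsto (fun M : ℕ => ((b - a) ^ 2 + 1) / 2 / √((M : ℝ) - 1) / a)
      atTop (nhds 0) := by
    have h1 : Tendsto (fun M : ℕ => √((M : ℝ) - 1)) atTop atTop :=
      Real.tendsto_sqrt_atTop.comp
        (tendsto_atTop_add_const_right _ (-1) tendsto_natCast_atTop_atTop)
    simpa using (h1.const_div_atTop (((b - a) ^ 2 + 1) / 2)).div_const a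
  rw [tendsto_iff_dist_tendsto_zero]
  refine squeeze_zero' (Eventually.of_forall fun _ => dist_nonneg) ?_ hrate
  filter_upwards [eventually_ge_atTop 2] with M hM
  have hM0 : (0 : ℝ) < M := by exact_mod_cast (by omega : 0 < M)
  set P := Measure.pi fun _ : Fin M => μ
  have hmp := fun i => measurePreserving_eval (fun _ : Fin M => μ) i
  have hAint : ∀ i, Integrable (fun W : Fin M → X => A (W i)) P := fun i =>
    (hmp i).integrable_comp_of_integrable hAi
  have hAeq : ∀ i, ∫ W, A (W i) ∂P = ∫ x, A x ∂μ := fun i => by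
    have := integral_map (μ := P) (hmp i).measurable.aemeasurable hA.aestronglyMeasurable
    rw [(hmp i).map_eq] at this
    exact this.symm
  have hlog := fun i : Fin M =>
    abs_integral_pi_log_sum_erase_sub_le (μ := μ) hm ha hKa hKb hM i
  have hsum : ∀ i, Integrable (fun W : Fin M → X =>
      A (W i) + Real.log (∑ j ∈ Finset.univ.erase i, K (W i) (W j))) P := fun i =>
    (hAint i).add (hlog i).1
  rw [integral_const_mul, integral_finsetSum _ fun i _ => hsum i]
  simp only [integral_add (hAint _) (hlog _).1, hAeq]
  set G := ∫ x, Real.log (∫ y, K x y ∂μ) ∂μ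
  set B := ∫ x, A x ∂μ
  set R := ((b - a) ^ 2 + 1) / 2 / √((M : ℝ) - 1) / a
  set J : Fin M → ℝ := fun i => ∫ W, Real.log (∑ j ∈ Finset.univ.erase i, K (W i) (W j)) ∂P
  have heq : 1 / (M : ℝ) * ∑ i, (B + J i) - Real.log ((M : ℝ) - 1) - (B + G) =
      (1 / (M : ℝ)) * ∑ i, (J i - Real.log ((M : ℝ) - 1) - G) := by
    simp only [Finset.sum_sub_distrib, Finset.sum_add_distrib, Finset.sum_const, Finset.card_univ,
      Fintype.card_fin, nsmul_eq_mul]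
    field_simp
    ring
  rw [Real.dist_eq, heq, abs_mul, abs_of_pos (by positivity)]
  calc 1 / (M : ℝ) * |∑ i, (J i - Real.log ((M : ℝ) - 1) - G)|
      ≤ 1 / (M : ℝ) * ∑ _i : Fin M, R := by
        gcongr
        exact (Finset.abs_sum_le_sum_abs _ _).trans (Finset.sum_le_sum fun i _ => (hlog i).2)
    _ = R := by
        rw [Finset.sum_const, Finset.card_univ, Fintype.card_fin, nsmul_eq_mul]
        field_simp

end UStatistic

lemma Sph.abs_inner_div_le {d : ℕ} {τ : ℝ} (hτ : 0 < τ) (x y : Sph d) :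
    |⟪(x : EuclideanSpace ℝ (Fin d)), (y : EuclideanSpace ℝ (Fin d))⟫ / τ| ≤ 1 / τ := by
  rw [abs_div, abs_of_pos hτ]
  gcongr
  simpa using abs_real_inner_le_norm (x : EuclideanSpace ℝ (Fin d)) (y : EuclideanSpace ℝ (Fin d))

lemma LdhelBatch_eq {d M : ℕ} (τ : ℝ) (hM : 2 ≤ M) (W : Fin M → Sph d × Sph d) :
    LdhelBatch d M τ W = (1 / (M : ℝ)) * ∑ i,
      (-(⟪((W i).1 : EuclideanSpace ℝ (Fin d)), ((W i).2 : EuclideanSpace ℝ (Fin d))⟫ / τ) +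
        Real.log (∑ j ∈ Finset.univ.erase i,
          Real.exp (⟪((W i).1 : EuclideanSpace ℝ (Fin d)),
            ((W j).1 : EuclideanSpace ℝ (Fin d))⟫ / τ))) := by
  rw [LdhelBatch]
  congr 1
  refine Finset.sum_congr rfl fun i _ => ?_
  have hne : (Finset.univ.erase i).Nonempty := by
    rw [← Finset.card_pos, Finset.card_erase_of_mem (Finset.mem_univ i), Finset.card_univ,
      Fintype.card_fin]
    omega
  rw [Real.log_div (Real.exp_pos _).ne' (Finset.sum_pos (fun j _ => Real.exp_pos _) hne).ne',
    Real.log_exp]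
  ring

theorem stmt_11 (d : ℕ) (τ : ℝ) (hτ : 0 < τ)
    (μ : Measure (Sph d × Sph d)) [IsProbabilityMeasure μ]
    (p : Measure (Sph d))
    (hp1 : μ.map Prod.fst = p) (hp2 : μ.map Prod.snd = p) :
    Tendsto
      (fun M : ℕ =>
        (∫ W, LdhelBatch d M τ W ∂(Measure.pi fun _ : Fin M => μ)) -
          Real.log ((M : ℝ) - 1))
      atTop
      (nhds
        ((∫ z, -(⟪(z.1 : EuclideanSpace ℝ (Fin d)), (z.2 : EuclideanSpace ℝ (Fin d))⟫ / τ) ∂μ) +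
          ∫ u', Real.log
              (∫ u, Real.exp (⟪(u : EuclideanSpace ℝ (Fin d)),
                  (u' : EuclideanSpace ℝ (Fin d))⟫ / τ) ∂p) ∂p)) := by
  have hA : Measurable fun z : Sph d × Sph d =>
      -(⟪(z.1 : EuclideanSpace ℝ (Fin d)), (z.2 : EuclideanSpace ℝ (Fin d))⟫ / τ) := by
    refine Continuous.measurable ?_
    fun_prop
  have hk : Continuous fun q : Sph d × Sph d =>
      Real.exp (⟪(q.1 : EuclideanSpace ℝ (Fin d)), (q.2 : EuclideanSpace ℝ (Fin d))⟫ / τ) := by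
    fun_prop
  have hlim := tendsto_integral_pi_average_log_sum_erase (μ := μ) hA
    (integrable_of_measurable_of_abs_le hA fun z => by
      rw [abs_neg]
      exact Sph.abs_inner_div_le hτ z.1 z.2)
    (K := fun z w =>
      Real.exp (⟪(z.1 : EuclideanSpace ℝ (Fin d)), (w.1 : EuclideanSpace ℝ (Fin d))⟫ / τ))
    (hk.comp (continuous_fst.fst.prodMk continuous_snd.fst)).measurable
    (Real.exp_pos (-(1 / τ)))
    (fun z w => Real.exp_le_exp.2 (neg_le_of_abs_le (Sph.abs_inner_div_le hτ z.1 w.1)))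
    (fun z w => Real.exp_le_exp.2 (le_of_abs_le (Sph.abs_inner_div_le hτ z.1 w.1)))
  have hinner : ∀ u' : Sph d,
      ∫ u, Real.exp (⟪(u : EuclideanSpace ℝ (Fin d)), (u' : EuclideanSpace ℝ (Fin d))⟫ / τ) ∂p =
        ∫ w, Real.exp (⟪(u' : EuclideanSpace ℝ (Fin d)),
          (w.1 : EuclideanSpace ℝ (Fin d))⟫ / τ) ∂μ := by
    intro u'
    rw [← hp1, integral_map measurable_fst.aemeasurable
      (f := fun u : Sph d =>
        Real.exp (⟪(u : EuclideanSpace ℝ (Fin d)), (u' : EuclideanSpace ℝ (Fin d))⟫ / τ))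
      (hk.comp (Continuous.prodMk_left u')).measurable.aestronglyMeasurable]
    refine integral_congr_ae (Eventually.of_forall fun w => ?_)
    dsimp only
    rw [real_inner_comm]
  have houter : Measurable fun u' : Sph d =>
      Real.log (∫ w, Real.exp (⟪(u' : EuclideanSpace ℝ (Fin d)),
        (w.1 : EuclideanSpace ℝ (Fin d))⟫ / τ) ∂μ) :=
    (StronglyMeasurable.integral_prod_right (f := fun (u' : Sph d) (w : Sph d × Sph d) =>
      Real.exp (⟪(u' : EuclideanSpace ℝ (Fin d)), (w.1 : EuclideanSpace ℝ (Fin d))⟫ / τ))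
      (hk.comp (continuous_fst.prodMk
        continuous_snd.fst)).measurable.stronglyMeasurable).measurable.log
  simp only [hinner]
  rw [← hp1, integral_map measurable_fst.aemeasurable houter.aestronglyMeasurable]
  refine hlim.congr' ?_
  filter_upwards [eventually_ge_atTop 2] with M hM
  simp only [LdhelBatch_eq τ hM]
end
end
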